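/- Under the multi-step algorithm setup below, assume additionally that −η_t·φ_{t,m} ≤ 1 for all t and m, and that η_t·d_t ≤ A_T for all 1 ≤ t ≤ T, where d_t = max_m φ_{t,m} − min_m φ_{t,m} and A_T ≥ 0. Then for every comparator path Λ_T = (λ_1,…,λ_T) with λ_t ∈ Ω_t and Τ(λ_t|λ_{t−1}) > 0 for all t, one has ∑_{t=1}^T ( ∑_{m=1}^M p_{t,m}·φ_{t,m} − φ_{t,ℓ_t(λ_t)} ) ≤ ∑_{t=1}^T η_t·v_t + (W(Λ_T) + A_T)/η_T, where v_t = ∑_{m=1}^M p_{t,m}·φ_{t,m}² and W(Λ_T) = log(max_{1≤t≤T} |Ω_{t−1}|) − log(∏_{t=1}^T Τ(λ_t|λ_{t−1})). -/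

import Mathlib

theorem exp_le_one_add_add_sq {x : ℝ} (hx : x ≤ 1) : Real.exp x ≤ 1 + x + x ^ 2 := by
  rcases le_or_gt (-1) x with h | h
  · have := (abs_le.mp (Real.abs_exp_sub_one_sub_id_le (abs_le.mpr ⟨h, hx⟩))).2
    linarith
  · have h1 : Real.exp x ≤ 1 := Real.exp_le_one_iff.mpr (by linarith)
    nlinarith

/-- Logarithmic form of the power mean inequality for an exponent `r ∈ (0, 1]`. -/
theorem log_sum_rpow_le {ι : Type*} (s : Finset ι) (z : ι → ℝ) (hz : ∀ i ∈ s, 0 ≤ z i)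
    {r : ℝ} (hr : 0 < r) (hr1 : r ≤ 1) (hs : 0 < ∑ i ∈ s, z i)
    (hs' : 0 < ∑ i ∈ s, z i ^ r) :
    Real.log (∑ i ∈ s, z i ^ r) ≤
      (1 - r) * Real.log s.card + r * Real.log (∑ i ∈ s, z i) := by
  have hcard : (0 : ℝ) < s.card := by
    have : s.Nonempty := Finset.nonempty_of_sum_ne_zero hs.ne'
    exact_mod_cast this.card_pos
  have h := Real.rpow_sum_le_const_mul_sum_rpow_of_nonneg (s := s) (f := fun i => z i ^ r)
    (p := r⁻¹) ((one_le_inv₀ hr).mpr hr1) (fun i hi => Real.rpow_nonneg (hz i hi) r)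
  have h2 : ∑ i ∈ s, (z i ^ r) ^ r⁻¹ = ∑ i ∈ s, z i :=
    Finset.sum_congr rfl fun i hi => Real.rpow_rpow_inv (hz i hi) hr.ne'
  rw [h2] at h
  have h3 := Real.log_le_log (Real.rpow_pos_of_pos hs' _) h
  rw [Real.log_rpow hs', Real.log_mul (Real.rpow_pos_of_pos hcard _).ne' hs.ne',
    Real.log_rpow hcard] at h3
  have h4 := mul_le_mul_of_nonneg_left h3 hr.le
  have h5 : r * (r⁻¹ * Real.log (∑ i ∈ s, z i ^ r)) = Real.log (∑ i ∈ s, z i ^ r) := by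
    field_simp
  have h6 : r * ((r⁻¹ - 1) * Real.log s.card + Real.log (∑ i ∈ s, z i)) =
      (1 - r) * Real.log s.card + r * Real.log (∑ i ∈ s, z i) := by
    field_simp
  rwa [h5, h6] at h4

/-- Second-order bound on the mix loss, where the learning rate `a` of the mix loss may exceed the
rate `b` for which the performance values are controlled. -/
theorem mean_sub_le_mixLoss {ι : Type*} (s : Finset ι) (q x : ι → ℝ)
    (hq : ∀ i ∈ s, 0 ≤ q i) (hq1 : ∑ i ∈ s, q i = 1) {a b A c : ℝ} (hb : 0 < b) (hab : b ≤ a)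
    (hx : ∀ i ∈ s, -b * x i ≤ 1) (hc : ∀ i ∈ s, c ≤ x i) (hA : ∀ i ∈ s, b * (x i - c) ≤ A) :
    ∑ i ∈ s, q i * x i - b * ∑ i ∈ s, q i * x i ^ 2 ≤
      -(Real.log (∑ i ∈ s, q i * Real.exp (-a * x i))) / a + (1 / b - 1 / a) * A := by
  have ha : 0 < a := hb.trans_le hab
  have hpos : ∀ k : ℝ, 0 < ∑ i ∈ s, q i * Real.exp (-k * x i) := by
    intro k
    obtain ⟨i, hi, hqi⟩ := Finset.exists_ne_zero_of_sum_ne_zero (hq1.trans_ne one_ne_zero)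
    exact Finset.sum_pos' (fun j hj => mul_nonneg (hq j hj) (Real.exp_pos _).le)
      ⟨i, hi, mul_pos (lt_of_le_of_ne (hq i hi) hqi.symm) (Real.exp_pos _)⟩
  set E := ∑ i ∈ s, q i * x i
  set V := ∑ i ∈ s, q i * x i ^ 2
  set Ma := ∑ i ∈ s, q i * Real.exp (-a * x i)
  set Mb := ∑ i ∈ s, q i * Real.exp (-b * x i)
  have hMb : Mb ≤ 1 - b * E + b ^ 2 * V := by
    calc Mb ≤ ∑ i ∈ s, (q i - b * (q i * x i) + b ^ 2 * (q i * x i ^ 2)) := by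
          refine Finset.sum_le_sum fun i hi => ?_
          have := mul_le_mul_of_nonneg_left (exp_le_one_add_add_sq (hx i hi)) (hq i hi)
          linarith
      _ = 1 - b * E + b ^ 2 * V := by
          rw [Finset.sum_add_distrib, Finset.sum_sub_distrib, hq1, Finset.mul_sum, Finset.mul_sum]
  have hlogb : Real.log Mb ≤ -b * E + b ^ 2 * V := by
    have := Real.log_le_sub_one_of_pos (hpos b)
    linarith
  have hMa : Ma ≤ Real.exp (-(a - b) * c) * Mb := by
    rw [Finset.mul_sum]
    refine Finset.sum_le_sum fun i hi => ?_
    have h1 : Real.exp (-a * x i) ≤ Real.exp (-(a - b) * c) * Real.exp (-b * x i) := by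
      rw [← Real.exp_add]
      refine Real.exp_le_exp.mpr ?_
      nlinarith [mul_nonneg (sub_nonneg.mpr hab) (sub_nonneg.mpr (hc i hi))]
    have := mul_le_mul_of_nonneg_left h1 (hq i hi)
    linarith
  have hloga : Real.log Ma ≤ -(a - b) * c + Real.log Mb := by
    have := Real.log_le_log (hpos a) hMa
    rwa [Real.log_mul (Real.exp_pos _).ne' (hpos b).ne', Real.log_exp] at this
  have hlow : -A - b * c ≤ Real.log Mb := by
    rw [Real.le_log_iff_exp_le (hpos b)]
    calc Real.exp (-A - b * c) = ∑ i ∈ s, q i * Real.exp (-A - b * c) := by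
          rw [← Finset.sum_mul, hq1, one_mul]
      _ ≤ Mb := by
          refine Finset.sum_le_sum fun i hi => mul_le_mul_of_nonneg_left
            (Real.exp_le_exp.mpr ?_) (hq i hi)
          linarith [hA i hi]
  have key : a * b * (E - b * V) ≤ -(b * Real.log Ma) + (a - b) * A := by
    nlinarith [mul_le_mul_of_nonneg_left hlogb ha.le, mul_le_mul_of_nonneg_left hloga hb.le,
      mul_le_mul_of_nonneg_left hlow (sub_nonneg.mpr hab)]
  have h2 : -(Real.log Ma) / a + (1 / b - 1 / a) * A =
      (-(b * Real.log Ma) + (a - b) * A) / (a * b) := by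
    field_simp
  rw [h2, le_div_iff₀ (mul_pos ha hb)]
  linarith

theorem sum_sum_filter_mul {ι κ : Type*} [Fintype κ] [DecidableEq κ] (s : Finset ι) (l : ι → κ)
    (w : ι → ℝ) (f : κ → ℝ) :
    ∑ m, (∑ a ∈ s.filter (fun a => l a = m), w a) * f m = ∑ a ∈ s, w a * f (l a) := by
  rw [← Finset.sum_fiberwise s l]
  refine Finset.sum_congr rfl fun m _ => ?_
  rw [Finset.sum_mul]
  refine Finset.sum_congr rfl fun a ha => ?_
  rw [(Finset.mem_filter.mp ha).2]

/-- Lemma 8 of the paper: the simplified master regret bound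
`∑ (E_p φ − φ_comparator) ≤ ∑ η_t v_t + (W(Λ_T) + A_T)/η_T`. -/
theorem stmt_9 (M T : ℕ) [NeZero M] (hM : 1 ≤ M) (hT : 1 ≤ T)
    {Λ : Type} (Ω : ℕ → Finset Λ)
    (hΩne : ∀ t, t ≤ T → (Ω t).Nonempty)
    (hΩ0 : (Ω 0).card = 1)
    (lab : ℕ → Λ → Fin M)
    (Tr : ℕ → Λ → Λ → ℝ)
    (hTr0 : ∀ t a b, 0 ≤ Tr t a b)
    (hTr1 : ∀ t, 1 ≤ t → t ≤ T → ∀ a ∈ Ω (t - 1), ∑ b ∈ Ω t, Tr t a b = 1)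
    (η : ℕ → ℝ)
    (hηpos : ∀ t, t ≤ T → 0 < η t)
    (hηdec : ∀ t, t < T → η (t + 1) ≤ η t)
    (φ : ℕ → Fin M → ℝ)
    (hφη : ∀ t, 1 ≤ t → t ≤ T → ∀ m, -η t * φ t m ≤ 1)
    (A : ℝ) (hA : 0 ≤ A)
    (hηd : ∀ t, 1 ≤ t → t ≤ T →
      η t * (Finset.univ.sup' Finset.univ_nonempty (φ t) -
        Finset.univ.inf' Finset.univ_nonempty (φ t)) ≤ A)
    (w z : ℕ → Λ → ℝ)
    (hw0 : ∀ a ∈ Ω 0, w 0 a = 1)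
    (hz0 : ∀ a ∈ Ω 0, z 0 a = 1)
    (hw : ∀ t, 1 ≤ t → t ≤ T → ∀ a ∈ Ω t,
      w t a = ∑ b ∈ Ω (t - 1), Tr t b a * z (t - 1) b ^ (η (t - 1) / η (t - 2)))
    (hz : ∀ t, 1 ≤ t → t ≤ T → ∀ a ∈ Ω t,
      z t a = w t a * Real.exp (-η (t - 1) * φ t (lab t a)))
    (p : ℕ → Fin M → ℝ)
    (hp : ∀ t, 1 ≤ t → t ≤ T → ∀ m,
      p t m = (∑ a ∈ (Ω t).filter (fun a => lab t a = m), w t a) /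
        ∑ m' : Fin M, ∑ a ∈ (Ω t).filter (fun a => lab t a = m'), w t a)
    (lam : ℕ → Λ)
    (hlam : ∀ t, t ≤ T → lam t ∈ Ω t)
    (hlamTr : ∀ t, 1 ≤ t → t ≤ T → 0 < Tr t (lam (t - 1)) (lam t)) :
    ∑ t ∈ Finset.Icc 1 T, ((∑ m, p t m * φ t m) - φ t (lab t (lam t))) ≤
      (∑ t ∈ Finset.Icc 1 T, η t * ∑ m, p t m * (φ t m) ^ 2)
      + ((Real.log (((Finset.Icc 1 T).sup fun t => (Ω (t - 1)).card : ℕ) : ℝ)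
          - Real.log (∏ t ∈ Finset.Icc 1 T, Tr t (lam (t - 1)) (lam t))) + A) / η T := by
  have hanti : ∀ s t, s ≤ t → t ≤ T → η t ≤ η s := by
    intro s t hst
    induction t, hst using Nat.le_induction with
    | base => exact fun _ => le_rfl
    | succ n hn ih => exact fun h => (hηdec n h).trans (ih (by omega))
  have hTrle : ∀ t, 1 ≤ t → t ≤ T → Tr t (lam (t - 1)) (lam t) ≤ 1 := by
    intro t h1 h2
    rw [← hTr1 t h1 h2 _ (hlam (t - 1) (by omega))]
    exact Finset.single_le_sum (f := fun b => Tr t (lam (t - 1)) b)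
      (fun b _ => hTr0 t _ b) (hlam t h2)
  set N : ℕ := (Finset.Icc 1 T).sup fun t => (Ω (t - 1)).card
  have hNle : ∀ n, n < T → (Ω n).card ≤ N := by
    intro n hn
    exact Finset.le_sup (f := fun t => (Ω (t - 1)).card) (b := n + 1)
      (Finset.mem_Icc.mpr ⟨by omega, hn⟩)
  have hlogN : 0 ≤ Real.log N := Real.log_natCast_nonneg N
  have hlogTr : Real.log (∏ t ∈ Finset.Icc 1 T, Tr t (lam (t - 1)) (lam t)) =
      ∑ t ∈ Finset.Icc 1 T, Real.log (Tr t (lam (t - 1)) (lam t)) :=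
    Real.log_prod fun t ht => (hlamTr t (Finset.mem_Icc.mp ht).1 (Finset.mem_Icc.mp ht).2).ne'
  have main : ∀ n, n ≤ T → (∀ a ∈ Ω n, 0 ≤ z n a) ∧ 0 < z n (lam n) ∧
      (∑ t ∈ Finset.Icc 1 n, Real.log (Tr t (lam (t - 1)) (lam t))) / η T
        - ∑ t ∈ Finset.Icc 1 n, φ t (lab t (lam t)) ≤ Real.log (z n (lam n)) / η (n - 1) ∧
      ∑ t ∈ Finset.Icc 1 n, ((∑ m, p t m * φ t m) - η t * ∑ m, p t m * (φ t m) ^ 2) ≤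
        (1 / η n - 1 / η 0) * A + (1 / η (n - 1) - 1 / η 0) * Real.log N
          - Real.log (∑ a ∈ Ω n, z n a) / η (n - 1) := by
    intro n
    induction n with
    | zero =>
      intro _
      have hl := hz0 _ (hlam 0 (by omega))
      refine ⟨fun a ha => by rw [hz0 a ha]; norm_num, by rw [hl]; norm_num, by simp [hl], ?_⟩
      rw [Finset.sum_congr rfl hz0]
      simp [hΩ0]
    | succ n ih =>
      intro hn
      obtain ⟨hznn, hzpos, hlow, hup⟩ := ih (by omega)
      have hw' := hw (n + 1) (by omega) hn
      have hz' := hz (n + 1) (by omega) hn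
      have hTr1' := hTr1 (n + 1) (by omega) hn
      have hp' := hp (n + 1) (by omega) hn
      have hTrpos := hlamTr (n + 1) (by omega) hn
      have hTrle' := hTrle (n + 1) (by omega) hn
      have e2 : n + 1 - 2 = n - 1 := by omega
      simp only [Nat.add_sub_cancel, e2] at hw' hz' hTr1' hTrpos hTrle' ⊢
      have hl := hlam (n + 1) hn
      have hηn : 0 < η n := hηpos n (by omega)
      have hηn1 : 0 < η (n - 1) := hηpos _ (by omega)
      have hηs : 0 < η (n + 1) := hηpos _ hn
      have hηT : 0 < η T := hηpos T le_rfl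
      set r := η n / η (n - 1) with hr
      have hr0 : 0 < r := div_pos hηn hηn1
      have hr1 : r ≤ 1 := (div_le_one hηn1).mpr (hanti _ _ (by omega) (by omega))
      have hzr : ∀ b ∈ Ω n, 0 ≤ z n b ^ r := fun b hb => Real.rpow_nonneg (hznn b hb) r
      have hwnn : ∀ a ∈ Ω (n + 1), 0 ≤ w (n + 1) a := fun a ha => by
        rw [hw' a ha]
        exact Finset.sum_nonneg fun b hb => mul_nonneg (hTr0 _ _ _) (hzr b hb)
      have hwge : Tr (n + 1) (lam n) (lam (n + 1)) * z n (lam n) ^ r ≤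
          w (n + 1) (lam (n + 1)) := by
        rw [hw' _ hl]
        exact Finset.single_le_sum (f := fun b => Tr (n + 1) b (lam (n + 1)) * z n b ^ r)
          (fun b hb => mul_nonneg (hTr0 _ _ _) (hzr b hb)) (hlam n (by omega))
      have hzrpos : 0 < z n (lam n) ^ r := Real.rpow_pos_of_pos hzpos r
      have hwpos : 0 < w (n + 1) (lam (n + 1)) := (mul_pos hTrpos hzrpos).trans_le hwge
      have hznn' : ∀ a ∈ Ω (n + 1), 0 ≤ z (n + 1) a := fun a ha => by
        rw [hz' a ha]
        exact mul_nonneg (hwnn a ha) (Real.exp_pos _).le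
      have hzpos' : 0 < z (n + 1) (lam (n + 1)) := by
        rw [hz' _ hl]
        exact mul_pos hwpos (Real.exp_pos _)
      refine ⟨hznn', hzpos', ?_, ?_⟩
      · rw [Finset.sum_Icc_succ_top (by omega), Finset.sum_Icc_succ_top (by omega),
          Nat.add_sub_cancel, hz' _ hl, Real.log_mul hwpos.ne' (Real.exp_pos _).ne', Real.log_exp]
        have h1 := Real.log_le_log (mul_pos hTrpos hzrpos) hwge
        rw [Real.log_mul hTrpos.ne' hzrpos.ne', Real.log_rpow hzpos] at h1
        have h2 : Real.log (Tr (n + 1) (lam n) (lam (n + 1))) / η T ≤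
            Real.log (Tr (n + 1) (lam n) (lam (n + 1))) / η n := by
          rw [div_eq_mul_one_div, div_eq_mul_one_div _ (η n)]
          exact mul_le_mul_of_nonpos_left
            (one_div_le_one_div_of_le hηT (hanti n T (by omega) le_rfl))
            (Real.log_nonpos hTrpos.le hTrle')
        have h3 := div_le_div_of_nonneg_right h1 hηn.le
        have h4 : (Real.log (Tr (n + 1) (lam n) (lam (n + 1))) + r * Real.log (z n (lam n))) / η n
            = Real.log (Tr (n + 1) (lam n) (lam (n + 1))) / η n
              + Real.log (z n (lam n)) / η (n - 1) := by
          rw [hr]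
          field_simp
        have h5 : (Real.log (w (n + 1) (lam (n + 1)))
            + -η n * φ (n + 1) (lab (n + 1) (lam (n + 1)))) / η n =
            Real.log (w (n + 1) (lam (n + 1))) / η n
              - φ (n + 1) (lab (n + 1) (lam (n + 1))) := by
          field_simp
          ring
        rw [h5, add_div]
        linarith
      · rw [Finset.sum_Icc_succ_top (by omega)]
        set W := ∑ a ∈ Ω (n + 1), w (n + 1) a with hW
        have hWpos : 0 < W := Finset.sum_pos' hwnn ⟨_, hl, hwpos⟩
        have hZpos : 0 < ∑ a ∈ Ω (n + 1), z (n + 1) a := Finset.sum_pos' hznn' ⟨_, hl, hzpos'⟩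
        have hZnpos : 0 < ∑ a ∈ Ω n, z n a :=
          Finset.sum_pos' hznn ⟨_, hlam n (by omega), hzpos⟩
        have hWeq : W = ∑ b ∈ Ω n, z n b ^ r := by
          rw [hW, Finset.sum_congr rfl hw', Finset.sum_comm]
          refine Finset.sum_congr rfl fun b hb => ?_
          rw [← Finset.sum_mul, hTr1' b hb, one_mul]
        have hlogW := log_sum_rpow_le (Ω n) (z n) hznn hr0 hr1 hZnpos (hWeq ▸ hWpos)
        rw [← hWeq] at hlogW
        have hcard : Real.log (Ω n).card ≤ Real.log N :=
          Real.log_le_log (by exact_mod_cast (hΩne n (by omega)).card_pos)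
            (by exact_mod_cast hNle n (by omega))
        have hlogW' : Real.log W / η n ≤ (1 / η n - 1 / η (n - 1)) * Real.log N
            + Real.log (∑ a ∈ Ω n, z n a) / η (n - 1) := by
          have h1 := hlogW.trans
            (add_le_add_left (mul_le_mul_of_nonneg_left hcard (sub_nonneg.mpr hr1)) _)
          refine (div_le_div_of_nonneg_right h1 hηn.le).trans_eq ?_
          rw [hr]
          field_simp
        have htot : ∑ m', ∑ a ∈ (Ω (n + 1)).filter (fun a => lab (n + 1) a = m'),
            w (n + 1) a = W := Finset.sum_fiberwise _ _ _
        rw [htot] at hp'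
        have hmean : ∀ f : Fin M → ℝ, ∑ m, p (n + 1) m * f m =
            (∑ a ∈ Ω (n + 1), w (n + 1) a * f (lab (n + 1) a)) / W := by
          intro f
          rw [← sum_sum_filter_mul (Ω (n + 1)) (lab (n + 1)) (w (n + 1)) f, Finset.sum_div]
          exact Finset.sum_congr rfl fun m _ => by rw [hp' m, div_mul_eq_mul_div]
        have hmix := mean_sub_le_mixLoss Finset.univ (p (n + 1)) (φ (n + 1))
          (a := η n) (b := η (n + 1)) (A := A)
          (c := Finset.univ.inf' Finset.univ_nonempty (φ (n + 1)))
          (fun m _ => by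
            rw [hp' m]
            exact div_nonneg (Finset.sum_nonneg fun a ha =>
              hwnn a (Finset.mem_filter.mp ha).1) hWpos.le)
          (by
            have := hmean fun _ => 1
            simp only [mul_one] at this
            rw [this, div_self hWpos.ne'])
          hηs (hηdec n (by omega)) (fun m _ => hφη (n + 1) (by omega) hn m)
          (fun m hm => Finset.inf'_le _ hm)
          (fun m hm => (mul_le_mul_of_nonneg_left
            (sub_le_sub_right (Finset.le_sup' (φ (n + 1)) hm) _) hηs.le).trans
            (hηd (n + 1) (by omega) hn))
        rw [hmean fun m => Real.exp (-η n * φ (n + 1) m),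
          ← Finset.sum_congr rfl hz', Real.log_div hZpos.ne' hWpos.ne', neg_sub, sub_div] at hmix
        linarith
  obtain ⟨hznn, hzpos, hlow, hup⟩ := main T le_rfl
  have hηT : 0 < η T := hηpos T le_rfl
  have hηT1 : 0 < η (T - 1) := hηpos _ (by omega)
  have hη0 : 0 < η 0 := hηpos 0 (by omega)
  have hZ : Real.log (z T (lam T)) / η (T - 1) ≤ Real.log (∑ a ∈ Ω T, z T a) / η (T - 1) :=
    div_le_div_of_nonneg_right (Real.log_le_log hzpos
      (Finset.single_le_sum hznn (hlam T le_rfl))) hηT1.le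
  have hN' : (1 / η (T - 1) - 1 / η 0) * Real.log N ≤ 1 / η T * Real.log N := by
    refine mul_le_mul_of_nonneg_right ?_ hlogN
    have := one_div_le_one_div_of_le hηT (hanti (T - 1) T (by omega) le_rfl)
    have := one_div_pos.mpr hη0
    linarith
  have hA' : (1 / η T - 1 / η 0) * A ≤ 1 / η T * A := by
    refine mul_le_mul_of_nonneg_right ?_ hA
    have := one_div_pos.mpr hη0
    linarith
  rw [Finset.sum_sub_distrib] at hup ⊢
  have hsplit : (Real.log N - ∑ t ∈ Finset.Icc 1 T, Real.log (Tr t (lam (t - 1)) (lam t)) + A) / η T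
      = 1 / η T * Real.log N
        - (∑ t ∈ Finset.Icc 1 T, Real.log (Tr t (lam (t - 1)) (lam t))) / η T + 1 / η T * A := by
    ring
  rw [hlogTr, hsplit]
  linarith
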